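/- arXiv:2512.15362 — 4 statements merged into one kernel-verified Lean document; each statement's English description precedes it below -/
import Mathlib

section
/- For every ψ > 0, all parameters ϑ, μ ∈ ℝ, and every real 2×2 matrix X, the exact identity (1/ψ) · Δ(ψ) · F_ψ(Δ(ψ)⁻¹ X Δ(ψ)⁻¹) · Δ(ψ) = F∞(X) holds, where F∞(X) = -(ϑ/2)(JX + XJ) + J - (μ²/4) X J X. In particular the rescaled Riccati vector field is autonomous (independent of ψ). -/
open Matrix Filter Set MeasureTheory

/-- The column vector `b(ψ) = (1, ψ)ᵀ`. -/
def bVec (ψ : ℝ) : Fin 2 → ℝ := ![1, ψ]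

/-- The column vector `ℓ(ψ) = (ψ, 1)ᵀ`. -/
def lVec (ψ : ℝ) : Fin 2 → ℝ := ![ψ, 1]

/-- The matrix `A(ψ) = b(ψ) ℓ(ψ)ᵀ = [[ψ, 1], [ψ², ψ]]`. -/
noncomputable def Amat (ψ : ℝ) : Matrix (Fin 2) (Fin 2) ℝ := vecMulVec (bVec ψ) (lVec ψ)

/-- The all-ones matrix `J = [[1,1],[1,1]]`. -/
def Jmat : Matrix (Fin 2) (Fin 2) ℝ := !![1, 1; 1, 1]

/-- The Riccati map `F_ψ(X) = -(ϑ/2)(A(ψ)X + X A(ψ)ᵀ) + b bᵀ - (μ²/4) X ℓ ℓᵀ X`. -/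
noncomputable def Fric (ψ ϑ μ : ℝ) (X : Matrix (Fin 2) (Fin 2) ℝ) : Matrix (Fin 2) (Fin 2) ℝ :=
  (-(ϑ / 2)) • (Amat ψ * X + X * (Amat ψ)ᵀ) + vecMulVec (bVec ψ) (bVec ψ)
    - (μ ^ 2 / 4) • (X * vecMulVec (lVec ψ) (lVec ψ) * X)

/-- The autonomous limiting Riccati map `F∞(X) = -(ϑ/2)(JX + XJ) + J - (μ²/4) X J X`. -/
noncomputable def Finf (ϑ μ : ℝ) (X : Matrix (Fin 2) (Fin 2) ℝ) : Matrix (Fin 2) (Fin 2) ℝ :=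
  (-(ϑ / 2)) • (Jmat * X + X * Jmat) + Jmat - (μ ^ 2 / 4) • (X * Jmat * X)

/-- The scaling matrix `Δ(ψ) = diag(ψ^{1/2}, ψ^{-1/2})`. -/
noncomputable def Dscale (ψ : ℝ) : Matrix (Fin 2) (Fin 2) ℝ :=
  Matrix.diagonal ![Real.sqrt ψ, (Real.sqrt ψ)⁻¹]

/-- For every `ψ > 0`, all `ϑ, μ ∈ ℝ` and every real 2×2 matrix `X`,
`(1/ψ) Δ(ψ) F_ψ(Δ(ψ)⁻¹ X Δ(ψ)⁻¹) Δ(ψ) = F∞(X)`: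
the rescaled Riccati vector field is autonomous. -/
theorem rescaled_riccati_autonomous (ψ : ℝ) (hψ : 0 < ψ) (ϑ μ : ℝ)
    (X : Matrix (Fin 2) (Fin 2) ℝ) :
    ψ⁻¹ • (Dscale ψ * Fric ψ ϑ μ ((Dscale ψ)⁻¹ * X * (Dscale ψ)⁻¹) * Dscale ψ)
      = Finf ϑ μ X := by
  have hs : 0 < √ψ := Real.sqrt_pos.mpr hψ
  have hinv : (Dscale ψ)⁻¹ = Matrix.diagonal ![(√ψ)⁻¹, √ψ] := by
    apply Matrix.inv_eq_right_inv
    ext i j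
    fin_cases i <;> fin_cases j <;> simp [Dscale, hs.ne']
  have hsq : ψ = √ψ ^ 2 := (Real.sq_sqrt hψ.le).symm
  rw [hinv]
  unfold Dscale Fric Finf Amat Jmat bVec lVec
  generalize √ψ = s at hs hsq
  subst hsq
  ext i j
  fin_cases i <;> fin_cases j <;>
    simp [Matrix.mul_apply, Fin.sum_univ_two, Matrix.diagonal_apply, Matrix.vecMul, dotProduct] <;>
    field_simp
end

section
/- Let ψ : I → (0, ∞) be differentiable on an interval I, and let Γ : I → M₂(ℝ) be differentiable and satisfy the Riccati ODE Γ'(t) = ψ(t)⁻¹ F_{ψ(t)}(Γ(t)) on I. Then the rescaled matrix Γ̃(t) := Δ(ψ(t)) Γ(t) Δ(ψ(t)) is differentiable and satisfies Γ̃'(t) = R(t) Γ̃(t) + Γ̃(t) R(t) + F∞(Γ̃(t)) on I, where R(t) = (1/2)(ψ'(t)/ψ(t)) · diag(1, -1) and F∞(X) = -(ϑ/2)(JX + XJ) + J - (μ²/4) X J X. -/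
open Matrix Filter Set MeasureTheory

attribute [local instance] Matrix.normedAddCommGroup Matrix.normedSpace

/-- The perturbation matrix `R = (r/2) diag(1,-1)`. -/
noncomputable def Rmat (r : ℝ) : Matrix (Fin 2) (Fin 2) ℝ :=
  (r / 2) • Matrix.diagonal ![(1 : ℝ), -1]

theorem hasDerivWithinAt_matrix_iff {m n : Type*} [Fintype m] [Fintype n] {f : ℝ → Matrix m n ℝ}
    {f' : Matrix m n ℝ} {s : Set ℝ} {t : ℝ} :
    HasDerivWithinAt f f' s t ↔ ∀ i j, HasDerivWithinAt (fun x => f x i j) (f' i j) s t :=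
  hasDerivWithinAt_pi.trans (forall_congr' fun _ => hasDerivWithinAt_pi)

theorem Dscale_mul_mul_Dscale_apply (ψ : ℝ) (X : Matrix (Fin 2) (Fin 2) ℝ) (i j : Fin 2) :
    (Dscale ψ * X * Dscale ψ) i j = Dscale ψ i i * X i j * Dscale ψ j j := by
  simp [Dscale]

theorem Dscale_mul_Fric_mul_Dscale {ψ : ℝ} (hψ : 0 < ψ) (ϑ μ : ℝ)
    (X : Matrix (Fin 2) (Fin 2) ℝ) :
    Dscale ψ * (ψ⁻¹ • Fric ψ ϑ μ X) * Dscale ψ = Finf ϑ μ (Dscale ψ * X * Dscale ψ) := by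
  obtain ⟨s, hs, rfl⟩ : ∃ s : ℝ, 0 < s ∧ ψ = s ^ 2 :=
    ⟨√ψ, Real.sqrt_pos.2 hψ, (Real.sq_sqrt hψ.le).symm⟩
  have hs' : √(s ^ 2) = s := Real.sqrt_sq hs.le
  ext i j
  fin_cases i <;> fin_cases j <;>
    simp [Dscale, Fric, Finf, Amat, Jmat, bVec, lVec, hs', Matrix.mul_apply, Fin.sum_univ_two,
      Matrix.vecMul, dotProduct, Matrix.diagonal_apply] <;>
    field_simp

theorem hasDerivWithinAt_Dscale_comp {ψ : ℝ → ℝ} {ψ' t : ℝ} {I : Set ℝ} (hpos : 0 < ψ t)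
    (hψ : HasDerivWithinAt ψ ψ' I t) (i : Fin 2) :
    HasDerivWithinAt (fun x => Dscale (ψ x) i i)
      (Rmat (ψ' / ψ t) i i * Dscale (ψ t) i i) I t := by
  have hs : 0 < √(ψ t) := Real.sqrt_pos.2 hpos
  have hsq : ψ t = √(ψ t) ^ 2 := (Real.sq_sqrt hpos.le).symm
  have hd := hψ.sqrt hpos.ne'
  fin_cases i
  · simp only [Dscale, Rmat, Matrix.smul_apply, Matrix.diagonal_apply_eq]
    refine hd.congr_deriv ?_
    generalize √(ψ t) = s at *
    simp [hsq]
    field_simp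
  · simp only [Dscale, Rmat, Matrix.smul_apply, Matrix.diagonal_apply_eq]
    refine (hd.inv hs.ne').congr_deriv ?_
    generalize √(ψ t) = s at *
    simp [hsq]
    field_simp

/-- If `Γ` solves the Riccati ODE `Γ' = ψ⁻¹ F_ψ(Γ)` on an interval `I`,
then the rescaled matrix `Γ̃ = Δ(ψ) Γ Δ(ψ)` solves
`Γ̃' = R Γ̃ + Γ̃ R + F∞(Γ̃)`, where `R = (1/2)(ψ'/ψ) diag(1,-1)`. -/
theorem rescaled_covariance_ode (ϑ μ : ℝ) (I : Set ℝ) (hI : I.OrdConnected)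
    (ψ ψ' : ℝ → ℝ) (hpos : ∀ t ∈ I, 0 < ψ t)
    (hψ : ∀ t ∈ I, HasDerivWithinAt ψ (ψ' t) I t)
    (Γ : ℝ → Matrix (Fin 2) (Fin 2) ℝ)
    (hΓ : ∀ t ∈ I, HasDerivWithinAt Γ ((ψ t)⁻¹ • Fric (ψ t) ϑ μ (Γ t)) I t) :
    ∀ t ∈ I, HasDerivWithinAt (fun s => Dscale (ψ s) * Γ s * Dscale (ψ s))
      (Rmat (ψ' t / ψ t) * (Dscale (ψ t) * Γ t * Dscale (ψ t))
        + (Dscale (ψ t) * Γ t * Dscale (ψ t)) * Rmat (ψ' t / ψ t)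
        + Finf ϑ μ (Dscale (ψ t) * Γ t * Dscale (ψ t))) I t := by
  intro t ht
  rw [← Dscale_mul_Fric_mul_Dscale (hpos t ht), hasDerivWithinAt_matrix_iff]
  intro i j
  have hprod := ((hasDerivWithinAt_Dscale_comp (hpos t ht) (hψ t ht) i).mul
    (hasDerivWithinAt_matrix_iff.1 (hΓ t ht) i j)).mul
    (hasDerivWithinAt_Dscale_comp (hpos t ht) (hψ t ht) j)
  simp_rw [Dscale_mul_mul_Dscale_apply _ (Γ _)]
  refine hprod.congr_deriv ?_
  have hR (r : ℝ) : Rmat r = diagonal ((r / 2) • ![(1 : ℝ), -1]) := (diagonal_smul _ _).symm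
  simp only [Matrix.add_apply, hR, diagonal_mul, mul_diagonal, diagonal_apply_eq,
    Dscale_mul_mul_Dscale_apply, Pi.mul_apply]
  ring
end

section
/- Let ϑ > 0, μ ≠ 0, let ρ : [t₀, ∞) → ℝ be continuous with ∫_{t₀}^{∞} |ρ(t)| dt < ∞, and let x : [t₀, ∞) → [0, ∞) be differentiable with x'(t) = 2 - 2ϑ x(t) - (μ²/2) x(t)² + ρ(t) for all t ≥ t₀. Then x(t) → 2g(ϑ) = 2(√(ϑ² + μ²) - ϑ)/μ² as t → ∞. -/
open Set Filter MeasureTheory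

/-- A primitive of an integrable function, normalised to vanish at infinity. -/
theorem exists_primitive_tendsto_zero {t₀ : ℝ} {ρ : ℝ → ℝ}
    (hρ_cont : ContinuousOn ρ (Ici t₀)) (hρ_int : IntegrableOn ρ (Ici t₀)) :
    ∃ P : ℝ → ℝ, (∀ t ∈ Ici t₀, HasDerivWithinAt P (ρ t) (Ici t) t) ∧
      ContinuousOn P (Ici t₀) ∧ Tendsto P atTop (nhds 0) := by
  have hii : ∀ t ∈ Ici t₀, IntervalIntegrable ρ volume t₀ t := fun t ht =>
    (intervalIntegrable_iff_integrableOn_Icc_of_le ht).2 (hρ_int.mono_set Icc_subset_Ici_self)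
  refine ⟨fun t => (∫ s in t₀..t, ρ s) - ∫ s in Ioi t₀, ρ s, fun t ht => ?_, fun t ht => ?_, ?_⟩
  · have hsub : Ici t ⊆ Ici t₀ := Ici_subset_Ici.2 ht
    refine HasDerivWithinAt.sub_const _
      (intervalIntegral.integral_hasDerivWithinAt_right (hii t ht) (t := Ioi t) ?_ ?_)
    · exact ⟨Ioi t, self_mem_nhdsWithin, (hρ_cont.mono
        (Ioi_subset_Ici_self.trans hsub)).aestronglyMeasurable measurableSet_Ioi⟩
    · exact (hρ_cont t ht).mono (Ioi_subset_Ici_self.trans hsub)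
  · have hcont : ContinuousOn (fun u => ∫ s in t₀..u, ρ s) (Icc t₀ (t + 1)) := by
      have h : t₀ ≤ t + 1 := by linarith [mem_Ici.1 ht]
      have := intervalIntegral.continuousOn_primitive_interval (a := t₀) (b := t + 1)
        (f := ρ) (μ := volume)
        (by rw [uIcc_of_le h]; exact hρ_int.mono_set Icc_subset_Ici_self)
      rwa [uIcc_of_le h] at this
    have hmem : Icc t₀ (t + 1) ∈ nhdsWithin t (Ici t₀) := by
      rw [← Ici_inter_Iic]
      exact inter_mem self_mem_nhdsWithin (mem_nhdsWithin_of_mem_nhds (Iic_mem_nhds (by linarith)))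
    exact ((hcont t ⟨ht, by linarith⟩).mono_of_mem_nhdsWithin hmem).sub continuousWithinAt_const
  · have := intervalIntegral_tendsto_integral_Ioi t₀ (hρ_int.mono_set Ioi_subset_Ici_self) tendsto_id
    simpa using this.sub_const (∫ s in Ioi t₀, ρ s)

/-- A solution of `y' = -a (y + P)` with damping `a ≥ k > 0` and `|P| ≤ ε` is eventually below
`3 ε`. -/
theorem eventually_le_of_damped {T k ε : ℝ} (hk : 0 < k) (hε : 0 < ε) {a P y : ℝ → ℝ}
    (ha : ∀ t ∈ Ici T, k ≤ a t) (hP : ∀ t ∈ Ici T, |P t| ≤ ε) (hyc : ContinuousOn y (Ici T))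
    (hy : ∀ t ∈ Ici T, HasDerivWithinAt y (-a t * (y t + P t)) (Ici t) t) :
    ∀ᶠ t in atTop, y t ≤ 3 * ε := by
  set B : ℝ → ℝ := fun t => 2 * ε + |y T| * Real.exp (-k * (t - T)) with hB
  have hB' : ∀ t, HasDerivAt B (|y T| * (Real.exp (-k * (t - T)) * (-k))) t := fun t => by
    have h : HasDerivAt (fun t => -k * (t - T)) (-k) t := by
      simpa using ((hasDerivAt_id t).sub_const T).const_mul (-k)
    exact (h.exp.const_mul _).const_add _
  have hle : ∀ t ∈ Ici T, y t ≤ B t := fun t ht => by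
    refine image_le_of_deriv_right_lt_deriv_boundary (hyc.mono Icc_subset_Ici_self)
      (fun s hs => hy s hs.1) ?_ hB' (fun s hs hsB => ?_) ⟨ht, le_rfl⟩
    · simp only [hB, sub_self, mul_zero, Real.exp_zero, mul_one]
      linarith [le_abs_self (y T)]
    · have hM : 0 ≤ |y T| * Real.exp (-k * (s - T)) := by positivity
      have hPs := (abs_le.1 (hP s hs.1)).1
      have has := ha s hs.1
      have hge : ε + |y T| * Real.exp (-k * (s - T)) ≤ y s + P s := by
        rw [hsB]; simp only [hB]; linarith
      have := mul_le_mul has hge (by positivity) (hk.le.trans has)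
      nlinarith [mul_pos hk hε]
  have hlim : Tendsto B atTop (nhds (2 * ε)) := by
    have h : Tendsto (fun t => -k * (t - T)) atTop atBot :=
      (tendsto_atTop_add_const_right _ (-T) tendsto_id).const_mul_atTop_of_neg (neg_lt_zero.2 hk)
    simpa [hB] using ((Real.tendsto_exp_atBot.comp h).const_mul |y T|).const_add (2 * ε)
  filter_upwards [hlim.eventually (gt_mem_nhds (by linarith : 2 * ε < 3 * ε)),
    eventually_ge_atTop T] with t ht hT
  exact (hle t hT).trans ht.le

/-- A solution of `e' = -a e + ρ` with damping bounded below and `ρ` integrable tends to zero. -/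
theorem tendsto_zero_of_damped {t₀ k : ℝ} (hk : 0 < k) {a ρ e : ℝ → ℝ}
    (ha : ∀ t ∈ Ici t₀, k ≤ a t)
    (hρ_cont : ContinuousOn ρ (Ici t₀)) (hρ_int : IntegrableOn ρ (Ici t₀))
    (he : ∀ t ∈ Ici t₀, HasDerivWithinAt e (-a t * e t + ρ t) (Ici t₀) t) :
    Tendsto e atTop (nhds 0) := by
  obtain ⟨P, hP', hPc, hP⟩ := exists_primitive_tendsto_zero hρ_cont hρ_int
  have hy' : ∀ t ∈ Ici t₀,
      HasDerivWithinAt (fun s => e s - P s) (-a t * (e t - P t + P t)) (Ici t) t := fun t ht => by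
    refine (((he t ht).mono (Ici_subset_Ici.2 ht)).sub (hP' t ht)).congr_deriv ?_
    ring
  have hyc : ContinuousOn (fun s => e s - P s) (Ici t₀) :=
    ContinuousOn.sub (fun t ht => (he t ht).continuousWithinAt) hPc
  have hy : Tendsto (fun s => e s - P s) atTop (nhds 0) := by
    rw [Metric.tendsto_nhds]
    intro δ hδ
    have hsmall : ∀ᶠ t in atTop, |P t| < δ / 4 := by
      simpa [Real.dist_eq] using Metric.tendsto_nhds.1 hP (δ / 4) (by linarith)
    obtain ⟨T, hT⟩ := eventually_atTop.1 (hsmall.and (eventually_ge_atTop t₀))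
    have hsub : Ici T ⊆ Ici t₀ := fun t ht => (hT t ht).2
    have h1 := eventually_le_of_damped hk (by linarith : 0 < δ / 4)
      (fun t ht => ha t (hsub ht)) (fun t ht => (hT t ht).1.le) (hyc.mono hsub)
      (fun t ht => hy' t (hsub ht))
    have h2 := eventually_le_of_damped hk (by linarith : 0 < δ / 4)
      (fun t ht => ha t (hsub ht)) (P := fun t => -P t) (y := fun t => -(e t - P t))
      (fun t ht => by simpa using (hT t ht).1.le) (hyc.mono hsub).neg
      (fun t ht => by
        refine (hy' t (hsub ht)).neg.congr_deriv ?_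
        ring)
    filter_upwards [h1, h2] with t ht1 ht2
    rw [Real.dist_eq, sub_zero, abs_lt]
    constructor <;> linarith
  simpa using hy.add hP

/-- The `(u,u)`-coordinate of the asymptotically autonomous rescaled
Riccati flow: a nonnegative solution of `x' = 2 - 2ϑx - (μ²/2)x² + ρ(t)` with integrable
continuous perturbation `ρ` converges to `2g(ϑ) = 2(√(ϑ²+μ²) - ϑ)/μ²`. -/
theorem riccati_scalar_convergence (ϑ μ t₀ : ℝ) (hϑ : 0 < ϑ) (hμ : μ ≠ 0)
    (ρ x : ℝ → ℝ)
    (hρ_cont : ContinuousOn ρ (Ici t₀))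
    (hρ_int : IntegrableOn (fun t => |ρ t|) (Ici t₀))
    (hx_nonneg : ∀ t ∈ Ici t₀, 0 ≤ x t)
    (hx : ∀ t ∈ Ici t₀, HasDerivWithinAt x
      (2 - 2 * ϑ * x t - μ ^ 2 / 2 * (x t) ^ 2 + ρ t) (Ici t₀) t) :
    Tendsto x atTop (nhds (2 * (Real.sqrt (ϑ ^ 2 + μ ^ 2) - ϑ) / μ ^ 2)) := by
  set c := 2 * (Real.sqrt (ϑ ^ 2 + μ ^ 2) - ϑ) / μ ^ 2 with hc
  have hc0 : 0 ≤ c := by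
    have : ϑ ≤ Real.sqrt (ϑ ^ 2 + μ ^ 2) := Real.le_sqrt_of_sq_le (by nlinarith [sq_nonneg μ])
    exact div_nonneg (by linarith) (sq_nonneg μ)
  have hroot : 2 - 2 * ϑ * c - μ ^ 2 / 2 * c ^ 2 = 0 := by
    have hs : Real.sqrt (ϑ ^ 2 + μ ^ 2) ^ 2 = ϑ ^ 2 + μ ^ 2 := Real.sq_sqrt (by positivity)
    rw [hc]
    field_simp
    linear_combination (-2) * hs
  have hρ : IntegrableOn ρ (Ici t₀) :=
    (integrable_norm_iff (hρ_cont.aestronglyMeasurable measurableSet_Ici)).1 hρ_int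
  have hlim : Tendsto (fun t => x t - c) atTop (nhds 0) := by
    refine tendsto_zero_of_damped (a := fun t => 2 * ϑ + μ ^ 2 / 2 * (x t + c))
      (by linarith : 0 < 2 * ϑ) (fun t ht => ?_) hρ_cont hρ (fun t ht => ?_)
    · have := hx_nonneg t ht
      exact le_add_of_nonneg_right (by positivity)
    · refine ((hx t ht).sub_const c).congr_deriv ?_
      linear_combination hroot
  simpa using hlim.add_const c
end

section
/- Let ϑ > 0, μ ≠ 0, t₀ ∈ ℝ, and let ψ : [t₀, ∞) → (0, ∞) be continuously differentiable with r(t) := ψ'(t)/ψ(t) satisfying r(t) → 0 as t → ∞ and ∫_{t₀}^{∞} |r(t)| dt < ∞. Let Γ̃ : [t₀, ∞) → M₂(ℝ) be differentiable, symmetric positive semidefinite for every t, and satisfy Γ̃'(t) = R(t)Γ̃(t) + Γ̃(t)R(t) + F∞(Γ̃(t)) with R(t) = (1/2) r(t) diag(1,-1). Then sup_{t ≥ t₀} ‖Γ̃(t)‖ < ∞, i.e. the family {Γ̃(t) : t ≥ t₀} is bounded in the cone of 2×2 symmetric nonnegative definite matrices. -/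
open Matrix Filter Set MeasureTheory

attribute [local instance] Matrix.normedAddCommGroup Matrix.normedSpace

/-- A continuous function on `[t₀, ∞)` with a limit at infinity is bounded. -/
theorem exists_abs_le_of_continuousOn_of_tendsto {f : ℝ → ℝ} {t₀ l : ℝ}
    (hf : ContinuousOn f (Ici t₀)) (hl : Tendsto f atTop (nhds l)) :
    ∃ K, 0 ≤ K ∧ ∀ t ∈ Ici t₀, |f t| ≤ K := by
  have hev : ∀ᶠ t in atTop, |f t| < |l| + 1 :=
    hl.abs.eventually_lt_const (lt_add_one _)
  obtain ⟨T, hT⟩ := eventually_atTop.1 hev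
  obtain ⟨C, hC⟩ := isCompact_Icc.exists_bound_of_continuousOn
    (hf.mono (Icc_subset_Ici_self : Icc t₀ T ⊆ Ici t₀))
  refine ⟨max C (|l| + 1), le_max_of_le_right (by positivity), fun t ht => ?_⟩
  rcases le_total t T with h | h
  · exact le_max_of_le_left (hC t ⟨ht, h⟩)
  · exact le_max_of_le_right (hT t h).le

/-- A function whose derivative is dominated by a nonnegative integrable function is bounded
above. -/
theorem exists_le_of_hasDerivWithinAt_le_integrable {f f' g : ℝ → ℝ} {t₀ : ℝ}
    (hf : ∀ t ∈ Ici t₀, HasDerivWithinAt f (f' t) (Ici t₀) t)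
    (hg : IntegrableOn g (Ici t₀)) (hg0 : ∀ t, 0 ≤ g t)
    (hle : ∀ t ∈ Ici t₀, f' t ≤ g t) :
    ∃ C, ∀ t ∈ Ici t₀, f t ≤ C := by
  refine ⟨f t₀ + ∫ t in Ici t₀, g t, fun t ht => ?_⟩
  have h := intervalIntegral.sub_le_integral_of_hasDeriv_right_of_le (g := f) (g' := f') (φ := g)
    (mem_Ici.1 ht)
    (fun x hx => ((hf x hx.1).continuousWithinAt.mono Icc_subset_Ici_self))
    (fun x hx => (hf x hx.1.le).mono fun y hy => hx.1.le.trans (mem_Ioi.1 hy).le)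
    (hg.mono_set Icc_subset_Ici_self) (fun x hx => hle x hx.1.le)
  have h2 : ∫ x in t₀..t, g x ≤ ∫ x in Ici t₀, g x := by
    rw [intervalIntegral.integral_of_le (mem_Ici.1 ht)]
    exact setIntegral_mono_set hg (ae_of_all _ hg0)
      (LE.le.eventuallyLE fun x hx => hx.1.le)
  linarith

/-- A function whose derivative is negative whenever it takes the value `M` stays below `M`. -/
theorem le_of_hasDerivWithinAt_neg {f f' : ℝ → ℝ} {t₀ M : ℝ}
    (hf : ∀ t ∈ Ici t₀, HasDerivWithinAt f (f' t) (Ici t₀) t) (h₀ : f t₀ ≤ M)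
    (hneg : ∀ t ∈ Ici t₀, f t = M → f' t < 0) :
    ∀ t ∈ Ici t₀, f t ≤ M := by
  intro t ht
  refine image_le_of_deriv_right_lt_deriv_boundary' (f := f) (f' := f') (B := fun _ => M)
    (B' := fun _ => 0) (a := t₀) (b := t)
    (fun x hx => ((hf x hx.1).continuousWithinAt.mono Icc_subset_Ici_self))
    (fun x hx => (hf x hx.1).mono (Ici_subset_Ici.2 hx.1)) h₀ continuousOn_const
    (fun x _ => hasDerivWithinAt_const _ _ _) (fun x hx => hneg x hx.1) ⟨ht, le_rfl⟩

theorem Matrix.hasDerivWithinAt_apply {X : ℝ → Matrix (Fin 2) (Fin 2) ℝ}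
    {X' : Matrix (Fin 2) (Fin 2) ℝ} {s : Set ℝ} {t : ℝ} (h : HasDerivWithinAt X X' s t)
    (i j : Fin 2) : HasDerivWithinAt (fun τ => X τ i j) (X' i j) s t :=
  hasDerivWithinAt_pi.1 (hasDerivWithinAt_pi.1 h i) j

/-- Entrywise inequalities for a real positive semidefinite `2 × 2` matrix. -/
theorem Matrix.PosSemidef.fin_two_entries {X : Matrix (Fin 2) (Fin 2) ℝ} (h : X.PosSemidef) :
    X 1 0 = X 0 1 ∧ 0 ≤ X 0 0 ∧ 0 ≤ X 1 1 ∧ |2 * X 0 1| ≤ X 0 0 + X 1 1 := by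
  have hs : X 1 0 = X 0 1 := by simpa using h.1.apply 0 1
  have h0 : 0 ≤ X 0 0 := h.diag_nonneg
  have h1 : 0 ≤ X 1 1 := h.diag_nonneg
  have hd := h.det_nonneg
  rw [Matrix.det_fin_two, hs] at hd
  exact ⟨hs, h0, h1, abs_le_of_sq_le_sq (by nlinarith [sq_nonneg (X 0 0 - X 1 1)]) (by positivity)⟩

/-- If `r = ψ'/ψ` tends to `0` and is integrable on `[t₀,∞)`, then any
symmetric positive semidefinite solution of
`Γ̃' = R Γ̃ + Γ̃ R + F∞(Γ̃)` with `R = (1/2) r diag(1,-1)` is bounded. -/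
theorem rescaled_covariance_bounded (ϑ μ t₀ : ℝ) (hϑ : 0 < ϑ) (hμ : μ ≠ 0)
    (ψ ψ' : ℝ → ℝ)
    (hψ_pos : ∀ t ∈ Ici t₀, 0 < ψ t)
    (hψ : ∀ t ∈ Ici t₀, HasDerivWithinAt ψ (ψ' t) (Ici t₀) t)
    (hψ'_cont : ContinuousOn ψ' (Ici t₀))
    (hr_lim : Tendsto (fun t => ψ' t / ψ t) atTop (nhds 0))
    (hr_int : IntegrableOn (fun t => |ψ' t / ψ t|) (Ici t₀))
    (Γ : ℝ → Matrix (Fin 2) (Fin 2) ℝ)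
    (hΓ_psd : ∀ t ∈ Ici t₀, (Γ t).PosSemidef)
    (hΓ : ∀ t ∈ Ici t₀, HasDerivWithinAt Γ
      (Rmat (ψ' t / ψ t) * Γ t + Γ t * Rmat (ψ' t / ψ t) + Finf ϑ μ (Γ t)) (Ici t₀) t) :
    ∃ M : ℝ, ∀ t ∈ Ici t₀, ‖Γ t‖ ≤ M := by
  obtain ⟨K, hK0, hK⟩ := exists_abs_le_of_continuousOn_of_tendsto
    (hψ'_cont.div (fun t ht => (hψ t ht).continuousWithinAt) fun t ht => (hψ_pos t ht).ne') hr_lim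
  set r : ℝ → ℝ := fun t => ψ' t / ψ t with hr
  have hμ2 : 0 < μ ^ 2 := by positivity
  have hent := fun t ht => (hΓ_psd t ht).fin_two_entries
  -- the quadratic forms of `Γ` along `(1, 1)` and `(1, -1)`, with the mixed form `b`
  set a : ℝ → ℝ := fun t => Γ t 0 0 + 2 * Γ t 0 1 + Γ t 1 1 with ha
  set b : ℝ → ℝ := fun t => Γ t 0 0 - Γ t 1 1 with hb
  set c : ℝ → ℝ := fun t => Γ t 0 0 - 2 * Γ t 0 1 + Γ t 1 1 with hc
  have hda : ∀ t ∈ Ici t₀, HasDerivWithinAt a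
      (r t * b t - 2 * ϑ * a t + 4 - μ ^ 2 / 4 * a t ^ 2) (Ici t₀) t := by
    intro t ht
    have hs := (hent t ht).1
    refine (((Matrix.hasDerivWithinAt_apply (hΓ t ht) 0 0).add
      ((Matrix.hasDerivWithinAt_apply (hΓ t ht) 0 1).const_mul 2)).add
      (Matrix.hasDerivWithinAt_apply (hΓ t ht) 1 1)).congr_deriv ?_
    simp [Rmat, Finf, Jmat, Matrix.mul_apply, Fin.sum_univ_two, Matrix.vecMul, dotProduct, ha, hb,
      hr, hs]
    ring
  have hdc : ∀ t ∈ Ici t₀, HasDerivWithinAt c (r t * b t - μ ^ 2 / 4 * b t ^ 2) (Ici t₀) t := by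
    intro t ht
    have hs := (hent t ht).1
    refine (((Matrix.hasDerivWithinAt_apply (hΓ t ht) 0 0).sub
      ((Matrix.hasDerivWithinAt_apply (hΓ t ht) 0 1).const_mul 2)).add
      (Matrix.hasDerivWithinAt_apply (hΓ t ht) 1 1)).congr_deriv ?_
    simp [Rmat, Finf, Jmat, Matrix.mul_apply, Fin.sum_univ_two, Matrix.vecMul, dotProduct, hb, hr,
      hs]
    ring
  have ha0 : ∀ t ∈ Ici t₀, 0 ≤ a t := fun t ht => by
    have := (abs_le.1 (hent t ht).2.2.2).1
    simp only [ha]; linarith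
  have hc0 : ∀ t ∈ Ici t₀, 0 ≤ c t := fun t ht => by
    have := (abs_le.1 (hent t ht).2.2.2).2
    simp only [hc]; linarith
  obtain ⟨C, hC⟩ := exists_le_of_hasDerivWithinAt_le_integrable hdc
    (hr_int.const_mul (K / μ ^ 2)) (fun t => by positivity) fun t ht => by
      have h1 : r t * b t - μ ^ 2 / 4 * b t ^ 2 ≤ r t ^ 2 / μ ^ 2 := by
        rw [le_div_iff₀ hμ2]
        nlinarith [sq_nonneg (r t - μ ^ 2 / 2 * b t)]
      have h2 : r t ^ 2 / μ ^ 2 ≤ K / μ ^ 2 * |r t| := by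
        rw [div_mul_eq_mul_div, ← sq_abs, sq]
        have : |r t| ≤ K := hK t ht
        gcongr
      exact h1.trans h2
  have hC0 : 0 ≤ C := (hc0 t₀ self_mem_Ici).trans (hC t₀ self_mem_Ici)
  have hat₀ := ha0 t₀ self_mem_Ici
  set M := a t₀ + 1 + C + 4 * (K + 5) / μ ^ 2 with hM
  have hq : 0 ≤ 4 * (K + 5) / μ ^ 2 := by positivity
  have haM : ∀ t ∈ Ici t₀, a t ≤ M := by
    refine le_of_hasDerivWithinAt_neg hda (by linarith) fun t ht hat => ?_
    have hbt : |b t| ≤ M := by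
      obtain ⟨-, h0, h1, -⟩ := hent t ht
      have h2 := hC t ht
      have h3 : a t + c t = 2 * (Γ t 0 0 + Γ t 1 1) := by simp only [ha, hc]; ring
      rw [abs_le]
      constructor <;> simp only [hb] <;> linarith
    have hrb : r t * b t ≤ K * M := by
      refine (le_abs_self _).trans ?_
      rw [abs_mul]
      exact mul_le_mul (hK t ht) hbt (abs_nonneg _) hK0
    have hμM : 4 * (K + 5) ≤ μ ^ 2 * M := by
      rw [mul_comm (μ ^ 2), ← div_le_iff₀ hμ2]; linarith
    have hM1 : 1 ≤ M := by linarith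
    rw [hat]
    nlinarith [mul_le_mul_of_nonneg_right hμM (by linarith : 0 ≤ M)]
  refine ⟨M + C, fun t ht => ?_⟩
  obtain ⟨hs, h0, h1, h01⟩ := hent t ht
  have htr : Γ t 0 0 + Γ t 1 1 ≤ M + C := by
    have h3 : a t + c t = 2 * (Γ t 0 0 + Γ t 1 1) := by simp only [ha, hc]; ring
    have := haM t ht
    have := hC t ht
    linarith
  rw [abs_le] at h01
  rw [Matrix.norm_le_iff (by linarith)]
  intro i j
  rw [Real.norm_eq_abs, abs_le]
  fin_cases i <;> fin_cases j <;> simp <;> constructor <;> linarith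
end
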